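/- Let f and g each belong to the following family of polynomials in ℝ[x,y]: x³ − y² + ε·x + J with ε ∈ {1, −1} and J ∈ ℝ; x³ − y² + ε with ε ∈ {1, −1}; x³ − y². If f ≈ g, then f = g. -/

import Mathlib

open MvPolynomial

/-- The polynomial ring `ℝ[x,y]`, realized as `MvPolynomial (Fin 2) ℝ`
with `X 0 = x` and `X 1 = y`. -/
abbrev P2 : Type := MvPolynomial (Fin 2) ℝ

/-- `f ∼ g` : there are an affine automorphism `θ ∈ Γ₂(ℝ)` (a ring automorphism
of `ℝ[x,y]` sending `x` and `y` to polynomials of total degree at most 1)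
and a nonzero `c ∈ ℝ` with `θ f = c • g`. -/
def AffEquiv (f g : P2) : Prop :=
  ∃ θ : P2 ≃+* P2, (θ (X 0)).totalDegree ≤ 1 ∧ (θ (X 1)).totalDegree ≤ 1 ∧
    ∃ c : ℝ, c ≠ 0 ∧ θ f = C c * g

/-- `f ≈ g` : there are a ring automorphism `φ` of `ℝ[x,y]` and a nonzero
`c ∈ ℝ` with `φ f = c • g`. -/
def AutEquiv (f g : P2) : Prop :=
  ∃ φ : P2 ≃+* P2, ∃ c : ℝ, c ≠ 0 ∧ φ f = C c * g

/-- The table entries of the form `x³ - y² + λ` with `λ` linear. -/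
def FamD' (p : P2) : Prop :=
  (∃ e J : ℝ, (e = 1 ∨ e = -1) ∧
    p = X 0 ^ 3 - X 1 ^ 2 + C e * X 0 + C J) ∨
  (∃ e : ℝ, (e = 1 ∨ e = -1) ∧ p = X 0 ^ 3 - X 1 ^ 2 + C e) ∨
  p = X 0 ^ 3 - X 1 ^ 2

/-- The chain rule for the image of a polynomial under an algebra endomorphism. -/
theorem pderiv_algHom (φ : P2 →ₐ[ℝ] P2) (i : Fin 2) (p : P2) :
    pderiv i (φ p) = φ (pderiv 0 p) * pderiv i (φ (X 0)) + φ (pderiv 1 p) * pderiv i (φ (X 1)) := by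
  induction p using MvPolynomial.induction_on with
  | C r =>
    have h : φ (C r) = C r := φ.commutes r
    simp [h]
  | add p q hp hq =>
    simp only [map_add, hp, hq]
    ring
  | mul_X p j hp =>
    simp only [map_mul, Derivation.leibniz, smul_eq_mul, hp, map_add]
    fin_cases j <;> simp [pderiv_X] <;> ring

/-- Ring automorphisms of `ℝ[x,y]` fix the constants. -/
theorem ringEquiv_C (φ : P2 ≃+* P2) (r : ℝ) : φ (C r) = C r := by
  have hconst : ∀ s : ℝ, φ (C s) = C (constantCoeff (φ (C s))) := by
    intro s
    by_cases hs : s = 0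
    · simp [hs]
    · have hu : IsUnit (φ (C s)) :=
        ((IsUnit.mk0 s hs).map (C : ℝ →+* P2)).map φ
      obtain ⟨t, -, ht⟩ := (MvPolynomial.isUnit_iff_eq_C_of_isReduced).1 hu
      simp [ht]
  have h : ((constantCoeff : P2 →+* ℝ).comp (φ : P2 →+* P2)).comp C = RingHom.id ℝ :=
    Subsingleton.elim _ _
  rw [hconst r]
  exact congrArg C (RingHom.congr_fun h r)

/-- The Jacobian determinant of an algebra automorphism of `ℝ[x,y]` is a nonzero constant. -/
theorem exists_jacobian_eq_C (φ : P2 ≃ₐ[ℝ] P2) :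
    ∃ k : ℝ, k ≠ 0 ∧ pderiv 0 (φ (X 0)) * pderiv 1 (φ (X 1)) -
      pderiv 1 (φ (X 0)) * pderiv 0 (φ (X 1)) = C k := by
  have key (i j : Fin 2) : pderiv i (X j : P2) =
      φ (pderiv 0 (φ.symm (X j))) * pderiv i (φ (X 0)) +
        φ (pderiv 1 (φ.symm (X j))) * pderiv i (φ (X 1)) := by
    have := pderiv_algHom (φ : P2 →ₐ[ℝ] P2) i (φ.symm (X j))
    simpa using this
  have h00 := key 0 0
  have h01 := key 0 1
  have h10 := key 1 0
  have h11 := key 1 1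
  simp only [pderiv_X, Pi.single_eq_same, ne_eq, one_ne_zero, zero_ne_one, not_false_eq_true,
    Pi.single_eq_of_ne] at h00 h01 h10 h11
  set A := φ (pderiv 0 (φ.symm (X 0)))
  set B := φ (pderiv 1 (φ.symm (X 0)))
  set E := φ (pderiv 0 (φ.symm (X 1)))
  set F := φ (pderiv 1 (φ.symm (X 1)))
  set p := pderiv 0 (φ (X 0))
  set q := pderiv 1 (φ (X 0))
  set r := pderiv 0 (φ (X 1))
  set s := pderiv 1 (φ (X 1))
  have hu : IsUnit (p * s - q * r) := by
    refine IsUnit.of_mul_eq_one (A * F - B * E) ?_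
    have : (p * s - q * r) * (A * F - B * E) =
        (A * p + B * r) * (E * q + F * s) - (A * q + B * s) * (E * p + F * r) := by ring
    rw [this, ← h00, ← h01, ← h10, ← h11]
    ring
  obtain ⟨k, hk, hk'⟩ := (MvPolynomial.isUnit_iff_eq_C_of_isReduced).1 hu
  exact ⟨k, hk.ne_zero, hk'⟩

/-- A critical point `(ξ, 0)` of `x³ - y² + a'x + b'` is carried to a critical point `(U, 0)` of
`x³ - y² + ax + b`, and the Hessians at these points are related by the Jacobian matrix. -/
theorem exists_criticalPoint {K : Type*} [Field K] [CharZero K] [Algebra ℝ K]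
    {u v : P2} {a b a' b' c k : ℝ} (hk : k ≠ 0)
    (h : u ^ 3 - v ^ 2 + C a * u + C b = C c * (X 0 ^ 3 - X 1 ^ 2 + C a' * X 0 + C b'))
    (hD : pderiv 0 u * pderiv 1 v - pderiv 1 u * pderiv 0 v = C k)
    (ξ : K) (hξ : 3 * ξ ^ 2 + algebraMap ℝ K a' = 0) :
    ∃ U s t : K, 3 * U ^ 2 + algebraMap ℝ K a = 0 ∧
      U * algebraMap ℝ K k ^ 2 = algebraMap ℝ K c ^ 2 * ξ ∧
      U ^ 3 + algebraMap ℝ K a * U + algebraMap ℝ K b =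
        algebraMap ℝ K c * (ξ ^ 3 + algebraMap ℝ K a' * ξ + algebraMap ℝ K b') ∧
      t ^ 2 - 3 * U * s ^ 2 = algebraMap ℝ K c := by
  have h2 (i : Fin 2) : pderiv i (2 : P2) = 0 := pderiv_C (a := (2 : ℝ))
  have h3 (i : Fin 2) : pderiv i (3 : P2) = 0 := pderiv_C (a := (3 : ℝ))
  have d (i : Fin 2) := congrArg (pderiv i) h
  have dd (i j : Fin 2) := congrArg (pderiv j) (d i)
  have e := congrArg (aeval ![ξ, 0]) h
  have e0 := congrArg (aeval ![ξ, 0]) (d 0)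
  have e1 := congrArg (aeval ![ξ, 0]) (d 1)
  have e00 := congrArg (aeval ![ξ, 0]) (dd 0 0)
  have e01 := congrArg (aeval ![ξ, 0]) (dd 0 1)
  have e11 := congrArg (aeval ![ξ, 0]) (dd 1 1)
  have eD := congrArg (aeval ![ξ, 0]) hD
  simp [pderiv_X, Derivation.leibniz_pow, h2, h3] at e e0 e1 e00 e01 e11 eD
  have hk' : algebraMap ℝ K k ≠ 0 := by simpa using hk
  set U := aeval ![ξ, 0] u
  set V := aeval ![ξ, 0] v
  set u0 := aeval ![ξ, 0] (pderiv 0 u)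
  set u1 := aeval ![ξ, 0] (pderiv 1 u)
  set v0 := aeval ![ξ, 0] (pderiv 0 v)
  set v1 := aeval ![ξ, 0] (pderiv 1 v)
  have hU : 3 * U ^ 2 + algebraMap ℝ K a = 0 := by
    refine (mul_eq_zero.1 ?_).resolve_right hk'
    rw [← eD]
    linear_combination v1 * e0 - v0 * e1 + algebraMap ℝ K c * v1 * hξ
  have hV : V = 0 := by
    have : 2 * V * algebraMap ℝ K k = 0 := by
      rw [← eD]
      linear_combination u1 * e0 - u0 * e1 + algebraMap ℝ K c * u1 * hξ
    simpa [hk'] using this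
  have q00 : 3 * U * u0 ^ 2 - v0 ^ 2 = 3 * algebraMap ℝ K c * ξ := by
    refine mul_left_cancel₀ (two_ne_zero (α := K)) ?_
    rw [hV] at e00
    linear_combination e00 - aeval ![ξ, 0] (pderiv 0 (pderiv 0 u)) * hU
  have q01 : 3 * U * u0 * u1 - v0 * v1 = 0 := by
    refine mul_left_cancel₀ (two_ne_zero (α := K)) ?_
    rw [hV] at e01
    linear_combination e01 - aeval ![ξ, 0] (pderiv 1 (pderiv 0 u)) * hU
  have q11 : 3 * U * u1 ^ 2 - v1 ^ 2 = -algebraMap ℝ K c := by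
    refine mul_left_cancel₀ (two_ne_zero (α := K)) ?_
    rw [hV] at e11
    linear_combination e11 - aeval ![ξ, 0] (pderiv 1 (pderiv 1 u)) * hU
  refine ⟨U, u1, v1, hU, ?_, ?_, ?_⟩
  · refine mul_left_cancel₀ (three_ne_zero (α := K)) ?_
    rw [← eD]
    linear_combination (-(3 * U * u1 ^ 2 - v1 ^ 2)) * q00 + (3 * U * u0 * u1 - v0 * v1) * q01 -
      3 * algebraMap ℝ K c * ξ * q11
  · rw [hV] at e
    linear_combination e
  · linear_combination -q11

/-- The coefficients `a`, `b` of `x³ - y² + ax + b` change under equivalence only by the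
weighted scaling coming from a positive factor. -/
theorem exists_scaling {a b a' b' : ℝ}
    (h : AutEquiv (X 0 ^ 3 - X 1 ^ 2 + C a * X 0 + C b) (X 0 ^ 3 - X 1 ^ 2 + C a' * X 0 + C b')) :
    ∃ c l : ℝ, 0 < c ∧ 0 < l ∧ b = c * b' ∧ a = l ^ 2 * a' ∧ a * l = c * a' := by
  obtain ⟨φ, c, hc, h⟩ := h
  let ψ : P2 ≃ₐ[ℝ] P2 := AlgEquiv.ofRingEquiv (f := φ) (ringEquiv_C φ)
  obtain ⟨k, hk, hD⟩ := exists_jacobian_eq_C ψ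
  simp only [map_add, map_sub, map_mul, map_pow, ringEquiv_C] at h
  change pderiv 0 (φ (X 0)) * pderiv 1 (φ (X 1)) -
    pderiv 1 (φ (X 0)) * pderiv 0 (φ (X 1)) = C k at hD
  by_cases ha' : a' = 0
  · subst ha'
    obtain ⟨U, s, t, h1, h2, h3, h4⟩ := exists_criticalPoint (K := ℝ) hk h hD 0 (by simp)
    simp only [Algebra.algebraMap_self, RingHom.id_apply] at h1 h2 h3 h4
    have hU : U = 0 := by simpa [hk] using h2
    subst hU
    have ha : a = 0 := by simpa using h1
    have hc' : 0 < c := lt_of_le_of_ne (by nlinarith [sq_nonneg t]) hc.symm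
    exact ⟨c, 1, hc', one_pos, by simpa using h3, by simp [ha], by simp [ha]⟩
  · obtain ⟨ξ, hξ⟩ := IsAlgClosed.exists_pow_nat_eq (-(a' : ℂ) / 3) (n := 2) two_pos
    have hξ' : 3 * ξ ^ 2 + (a' : ℂ) = 0 := by rw [hξ]; ring
    have hξ0 : ξ ≠ 0 := by
      rintro rfl
      simp [ha'] at hξ'
    obtain ⟨U, -, -, h1, h2, h3, -⟩ := exists_criticalPoint (K := ℂ) hk h hD ξ hξ'
    obtain ⟨W, -, -, -, k2, k3, -⟩ :=
      exists_criticalPoint (K := ℂ) hk h hD (-ξ) (by simpa using hξ')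
    simp only [Complex.coe_algebraMap] at h1 h2 h3 k2 k3
    have hk' : (k : ℂ) ≠ 0 := by exact_mod_cast hk
    set l : ℂ := (c : ℂ) ^ 2 / (k : ℂ) ^ 2 with hl
    have hU : U = l * ξ := by rw [hl]; field_simp; linear_combination h2
    have hW : W = -(l * ξ) := by rw [hl]; field_simp; linear_combination k2
    subst hU hW
    have e1 : (a : ℂ) = l ^ 2 * a' := by linear_combination h1 - l ^ 2 * hξ'
    have e2 : (b : ℂ) = c * b' := by linear_combination (h3 + k3) / 2
    have e3 : (a : ℂ) * l = c * a' := by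
      refine mul_right_cancel₀ hξ0 ?_
      linear_combination (3 / 4) * (h3 - k3) - l * ξ / 2 * h1 + c * ξ / 2 * hξ'
    have e1' : a = (c ^ 2 / k ^ 2) ^ 2 * a' := by
      rw [hl] at e1
      exact_mod_cast e1
    have e2' : b = c * b' := by exact_mod_cast e2
    have e3' : a * (c ^ 2 / k ^ 2) = c * a' := by
      rw [hl] at e3
      exact_mod_cast e3
    have hlpos : 0 < c ^ 2 / k ^ 2 := by positivity
    have hcl : c = (c ^ 2 / k ^ 2) ^ 3 := by
      refine mul_right_cancel₀ ha' ?_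
      linear_combination (c ^ 2 / k ^ 2) * e1' - e3'
    exact ⟨c, _, hcl ▸ by positivity, hlpos, e2', e1', e3'⟩

theorem FamD'.exists_coeffs {p : P2} (h : FamD' p) :
    ∃ a b : ℝ, p = X 0 ^ 3 - X 1 ^ 2 + C a * X 0 + C b ∧
      ((a = 1 ∨ a = -1) ∨ a = 0 ∧ (b = 1 ∨ b = -1 ∨ b = 0)) := by
  rcases h with ⟨e, J, he, rfl⟩ | ⟨e, he, rfl⟩ | rfl
  · exact ⟨e, J, rfl, Or.inl he⟩
  · exact ⟨0, e, by simp, Or.inr ⟨rfl, by tauto⟩⟩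
  · exact ⟨0, 0, by simp, by simp⟩

theorem stmt18 (f g : P2) (hf : FamD' f) (hg : FamD' g) (h : AutEquiv f g) :
    f = g := by
  obtain ⟨a, b, rfl, hab⟩ := hf.exists_coeffs
  obtain ⟨a', b', rfl, hab'⟩ := hg.exists_coeffs
  obtain ⟨c, l, hc, hl, hb, ha, hal⟩ := exists_scaling h
  suffices a = a' ∧ b = b' by rw [this.1, this.2]
  have hunit (ha' : a' ≠ 0) (haa : a ^ 2 = a' ^ 2) : a = a' ∧ b = b' := by
    have hl4 : l ^ 4 = 1 := by
      refine mul_right_cancel₀ (pow_ne_zero 2 ha') ?_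
      linear_combination haa - (a + l ^ 2 * a') * ha
    have hl1 : l = 1 := (pow_eq_one_iff_of_nonneg hl.le (by norm_num)).1 hl4
    subst hl1
    have haa' : a = a' := by simpa using ha
    subst haa'
    have hc1 : c = 1 := mul_right_cancel₀ ha' (by linear_combination -hal)
    exact ⟨rfl, by simpa [hc1] using hb⟩
  rcases hab with hab | ⟨rfl, hab⟩
  · rcases hab' with hab' | ⟨rfl, -⟩
    · exact hunit (by rcases hab' with rfl | rfl <;> norm_num)
        (by rcases hab with rfl | rfl <;> rcases hab' with rfl | rfl <;> norm_num)
    · rcases hab with rfl | rfl <;> norm_num at ha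
  · have ha' : a' = 0 := by simpa [hl.ne'] using ha.symm
    refine ⟨ha'.symm, ?_⟩
    have hab'' : b' = 1 ∨ b' = -1 ∨ b' = 0 := by
      rcases hab' with (h1 | h1) | h1
      · norm_num [h1] at ha'
      · norm_num [h1] at ha'
      · exact h1.2
    rcases hab with rfl | rfl | rfl <;> rcases hab'' with rfl | rfl | rfl <;> grind
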